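/- arXiv:0812.3841 — 3 statements merged into one kernel-verified Lean document; each statement's English description precedes it below -/
import Mathlib

section
/- For every natural number n, the support of D_n (the set of group elements at which D_n is nonzero, as a finitely supported function F → ℤ × ℤ) has exactly 2n + 1 elements. -/
namespace LargeSpheres

/-- The free group `F` on two generators. -/
abbrev F : Type := FreeGroup Bool

/-- The first generator `a` of `F`. -/
def a : F := FreeGroup.of true

/-- The second generator `c` of `F`. -/
def c : F := FreeGroup.of false

/-- `A_g = single g (1,0)` in the free `ℤ`-module `F →₀ ℤ × ℤ`. -/
noncomputable def A (g : F) : F →₀ ℤ × ℤ := Finsupp.single g (1, 0)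

/-- `C_g = A_g + B_g = single g (1,1)` in the free `ℤ`-module `F →₀ ℤ × ℤ`. -/
noncomputable def C (g : F) : F →₀ ℤ × ℤ := Finsupp.single g (1, 1)

/-- `D_n = -A_{cⁿa⁻¹} + Σ_{k=1}^{n} ( C_{c^{k-1}} − C_{cⁿa⁻¹c^{-k}} )`. -/
noncomputable def D (n : ℕ) : F →₀ ℤ × ℤ :=
  -A (c ^ n * a⁻¹) + ∑ k ∈ Finset.Icc 1 n, (C (c ^ (k - 1)) - C (c ^ n * a⁻¹ * (c ^ k)⁻¹))

/-- A finite sum of nonzero point masses at distinct points has as many points in its support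
as there are summands. -/
theorem card_support_sum_single {ι α M : Type*} [AddCommMonoid M] (s : Finset ι)
    (f : ι → α) (v : ι → M) (hf : Function.Injective f) (hv : ∀ i, v i ≠ 0) :
    (∑ i ∈ s, Finsupp.single (f i) (v i)).support.card = s.card := by
  classical
  induction s using Finset.induction_on with
  | empty => simp
  | insert i s hi ih =>
    have h : f i ∉ (∑ j ∈ s, Finsupp.single (f j) (v j)).support := by
      rw [Finsupp.notMem_support_iff, Finsupp.finsetSum_apply]
      refine Finset.sum_eq_zero fun j hj => Finsupp.single_eq_of_ne fun h => hi ?_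
      exact hf h ▸ hj
    rw [Finset.sum_insert hi, Finsupp.support_single_add h (hv i), Finset.card_cons, ih,
      Finset.card_insert_of_notMem hi]

/-- The abelianization map of `F`, recording the exponent sums of `a` and `c`. -/
def exponents : F →* Multiplicative (ℤ × ℤ) :=
  FreeGroup.lift fun b => Multiplicative.ofAdd (if b then (1, 0) else (0, 1))

theorem exponents_pow (k : ℕ) : (exponents (c ^ k)).toAdd = (0, (k : ℤ)) := by
  simp [exponents, c]

theorem exponents_mul (n k : ℕ) :
    (exponents (c ^ n * a⁻¹ * (c ^ k)⁻¹)).toAdd = (-1, (n : ℤ) - k) := by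
  simp [exponents, a, c, sub_eq_add_neg]

/-- The points `cᵏ` and `cⁿa⁻¹c⁻ᵏ`, for natural numbers `k`, are pairwise distinct. -/
theorem injective_points (n : ℕ) :
    Function.Injective
      (Sum.elim (fun k : ℕ => c ^ k) fun k : ℕ => c ^ n * a⁻¹ * (c ^ k)⁻¹) := by
  intro x y h
  have hxy := congrArg (fun g => (exponents g).toAdd) h
  rcases x with x | x <;> rcases y with y | y <;>
    simp only [Sum.elim_inl, Sum.elim_inr, exponents_pow, exponents_mul, Prod.mk.injEq] at hxy <;>
    grind

theorem D_eq_sum_single (n : ℕ) :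
    D n = ∑ x ∈ (Finset.range n).disjSum (Finset.range (n + 1)),
      Finsupp.single
        (Sum.elim (fun k : ℕ => c ^ k) (fun k : ℕ => c ^ n * a⁻¹ * (c ^ k)⁻¹) x)
        (Sum.elim (fun _ => (1, 1)) (fun k : ℕ => if k = 0 then (-1, 0) else (-1, -1)) x :
          ℤ × ℤ) := by
  have hA : -A (c ^ n * a⁻¹) = Finsupp.single (c ^ n * a⁻¹) (-1, 0) := by
    simp [A, ← Finsupp.single_neg]
  have hC (g : F) : Finsupp.single g (-1, -1) = -C g := by
    simp [C, ← Finsupp.single_neg]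
  rw [D, Finset.sum_disjSum, Finset.sum_range_succ', ← Finset.Ico_add_one_right_eq_Icc,
    Finset.sum_Ico_eq_sum_range, hA]
  simp only [Sum.elim_inl, Sum.elim_inr, Nat.add_eq_zero_iff, one_ne_zero, and_false, if_false,
    if_true, pow_zero, inv_one, mul_one, hC, Finset.sum_sub_distrib, Finset.sum_neg_distrib,
    add_tsub_cancel_right, add_comm 1]
  simp only [C]
  abel

/-- The support of `D_n` has exactly `2n + 1` elements. -/
theorem card_support_D (n : ℕ) : (D n).support.card = 2 * n + 1 := by
  rw [D_eq_sum_single, card_support_sum_single _ _ _ (injective_points n)]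
  · simp only [Finset.card_disjSum, Finset.card_range]
    ring
  · rintro (k | k)
    · simp
    · simp only [Sum.elim_inr]
      split_ifs <;> simp

end LargeSpheres
end

section
/- For every natural number n, the support of D_{n+1/2} (the set of group elements at which D_{n+1/2} is nonzero, as a finitely supported function F → ℤ × ℤ) has exactly 2n + 2 elements. -/
namespace LargeSpheres

/-- `D_{n+1/2} = A_{cⁿ} + Σ_{k=1}^{n} ( C_{c^{k-1}} − C_{cⁿac^{-k}} ) − C_{cⁿac^{-(n+1)}}`. -/
noncomputable def Dhalf (n : ℕ) : F →₀ ℤ × ℤ :=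
  A (c ^ n) + ∑ k ∈ Finset.Icc 1 n, (C (c ^ (k - 1)) - C (c ^ n * a * (c ^ k)⁻¹))
    - C (c ^ n * a * (c ^ (n + 1))⁻¹)

/-- The exponent sum of the generator `x` in a word of `F`. -/
def exponentSum (x : Bool) : F →* Multiplicative ℤ :=
  FreeGroup.lift fun y => Multiplicative.ofAdd (if y = x then 1 else 0)

lemma pow_c_injective : Function.Injective fun i : ℕ => c ^ i := by
  intro i j h
  have := congrArg (fun g => (exponentSum false g).toAdd) h
  simpa [exponentSum, c] using this

lemma mul_a_mul_pow_c_inv_injective (n : ℕ) :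
    Function.Injective fun i : ℕ => c ^ n * a * (c ^ (i + 1))⁻¹ := by
  intro i j h
  exact Nat.succ_injective (pow_c_injective (inv_injective (mul_left_cancel h)))

lemma pow_c_ne_mul_a_mul_pow_c_inv (n i j : ℕ) : c ^ i ≠ c ^ n * a * (c ^ j)⁻¹ := by
  intro h
  have := congrArg (fun g => (exponentSum true g).toAdd) h
  simp [exponentSum, a, c] at this

/-- A sum of nonzero single functions at distinct points is supported at exactly these points. -/
lemma support_sum_single {ι α M : Type*} [DecidableEq α] [AddCommMonoid M] (s : Finset ι)
    {f : ι → α} (hf : Function.Injective f) {v : ι → M} (hv : ∀ i, v i ≠ 0) :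
    (∑ i ∈ s, Finsupp.single (f i) (v i)).support = s.image f := by
  classical
  induction s using Finset.induction_on with
  | empty => simp
  | insert i s hi ih =>
    rw [Finset.sum_insert hi, Finset.image_insert, Finsupp.support_add_eq, ih,
      Finsupp.support_single _ (hv i), Finset.insert_eq]
    rw [ih, Finsupp.support_single _ (hv i)]
    simpa [hf.eq_iff] using hi

/-- `D_{n+1/2}` as a sum of single functions at distinct points. -/
lemma Dhalf_eq_sum_single (n : ℕ) :
    Dhalf n =
      ∑ i ∈ Finset.range (n + 1), Finsupp.single (c ^ i) (if i = n then (1, 0) else (1, 1)) +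
      ∑ i ∈ Finset.range (n + 1), Finsupp.single (c ^ n * a * (c ^ (i + 1))⁻¹) (-1, -1) := by
  have hneg (g : F) : (Finsupp.single g (-1, -1) : F →₀ ℤ × ℤ) = -C g := by
    rw [C, ← Finsupp.single_neg]; rfl
  have hC : ∑ i ∈ Finset.range n,
      Finsupp.single (c ^ i) (if i = n then ((1, 0) : ℤ × ℤ) else (1, 1)) =
        ∑ i ∈ Finset.range n, C (c ^ i) :=
    Finset.sum_congr rfl fun i hi => by rw [if_neg (Finset.mem_range.1 hi).ne, C]
  rw [Finset.sum_range_succ, Finset.sum_range_succ, hC, if_pos rfl, Dhalf, A,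
    ← Finset.Ico_add_one_right_eq_Icc, Finset.sum_Ico_eq_sum_range]
  simp only [hneg, Finset.sum_sub_distrib, Finset.sum_neg_distrib, Nat.add_sub_cancel,
    Nat.add_comm 1]
  abel

/-- The support of `D_{n+1/2}` has exactly `2n + 2` elements. -/
theorem card_support_Dhalf (n : ℕ) : (Dhalf n).support.card = 2 * n + 2 := by
  have hv (i : ℕ) : (if i = n then ((1, 0) : ℤ × ℤ) else (1, 1)) ≠ 0 := by
    split_ifs <;> simp
  have hw (_ : ℕ) : ((-1, -1) : ℤ × ℤ) ≠ 0 := by simp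
  have hpow := support_sum_single (Finset.range (n + 1)) pow_c_injective hv
  have hmul := support_sum_single (Finset.range (n + 1)) (mul_a_mul_pow_c_inv_injective n) hw
  have hdisj : Disjoint ((Finset.range (n + 1)).image fun i => c ^ i)
      ((Finset.range (n + 1)).image fun i => c ^ n * a * (c ^ (i + 1))⁻¹) := by
    simp only [Finset.disjoint_left, Finset.mem_image]
    rintro _ ⟨i, _, rfl⟩ ⟨j, _, h⟩
    exact pow_c_ne_mul_a_mul_pow_c_inv n i (j + 1) h.symm
  rw [Dhalf_eq_sum_single, Finsupp.support_add_eq (by rwa [hpow, hmul]), hpow, hmul,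
    Finset.card_union_of_disjoint hdisj, Finset.card_image_of_injective _ pow_c_injective,
    Finset.card_image_of_injective _ (mul_a_mul_pow_c_inv_injective n), Finset.card_range]
  ring

end LargeSpheres
end

section
/- Consider the left-translation action of F on M = F →₀ (ℤ × ℤ), determined by g • (single h v) = single (g·h) v. Then the elements D_n and D_{m+1/2} (n, m ∈ ℕ) lie in pairwise distinct F-orbits: (i) if n ≠ m then there is no g ∈ F with g • D_n = D_m; (ii) if n ≠ m then there is no g ∈ F with g • D_{n+1/2} = D_{m+1/2}; and (iii) for all n, m ∈ ℕ there is no g ∈ F with g • D_n = D_{m+1/2}. -/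
namespace LargeSpheres

/-- The left-translation action of `F` on `F →₀ ℤ × ℤ`, determined by
`g • single h v = single (g * h) v`. -/
noncomputable def act (g : F) (m : F →₀ ℤ × ℤ) : F →₀ ℤ × ℤ :=
  Finsupp.mapDomain (fun h => g * h) m

/-- The exponent sum of the generator `a`. -/
def aExponent : F →* Multiplicative ℤ :=
  FreeGroup.lift fun b => Multiplicative.ofAdd (if b then 1 else 0)

theorem toAdd_aExponent_a : (aExponent a).toAdd = 1 := by
  simp [aExponent, a]

theorem toAdd_aExponent_c : (aExponent c).toAdd = 0 := by
  simp [aExponent, c]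

/-- The sum of all values of a finitely supported function. -/
noncomputable def total : (F →₀ ℤ × ℤ) →+ ℤ × ℤ :=
  Finsupp.liftAddHom fun _ => AddMonoidHom.id _

/-- The sum of all values, each weighted by the `a`-exponent of its position. -/
noncomputable def moment : (F →₀ ℤ × ℤ) →+ ℤ × ℤ :=
  Finsupp.liftAddHom fun h => (aExponent h).toAdd • AddMonoidHom.id _

theorem total_single (h : F) (v : ℤ × ℤ) : total (Finsupp.single h v) = v := by
  simp [total]

theorem moment_single (h : F) (v : ℤ × ℤ) :
    moment (Finsupp.single h v) = (aExponent h).toAdd • v := by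
  simp [moment]

theorem total_act (g : F) (x : F →₀ ℤ × ℤ) : total (act g x) = total x := by
  induction x using Finsupp.induction_linear with
  | zero => simp [act]
  | add x y hx hy =>
    simp only [act, Finsupp.mapDomain_add, map_add] at hx hy ⊢
    rw [hx, hy]
  | single h v => simp [act, Finsupp.mapDomain_single, total_single]

theorem moment_act (g : F) (x : F →₀ ℤ × ℤ) :
    moment (act g x) = (aExponent g).toAdd • total x + moment x := by
  induction x using Finsupp.induction_linear with
  | zero => simp [act]
  | add x y hx hy =>
    simp only [act, Finsupp.mapDomain_add, map_add] at hx hy ⊢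
    rw [hx, hy, smul_add]
    abel
  | single h v =>
    simp only [act, Finsupp.mapDomain_single, total_single, moment_single, map_mul, toAdd_mul,
      add_smul]

theorem total_D (n : ℕ) : total (D n) = (-1, 0) := by
  simp [D, A, C, total_single]

theorem total_Dhalf (n : ℕ) : total (Dhalf n) = (0, -1) := by
  simp [Dhalf, A, C, total_single]

theorem moment_D (n : ℕ) : moment (D n) = ((n : ℤ) + 1, (n : ℤ)) := by
  simp [D, A, C, moment_single, toAdd_aExponent_a, toAdd_aExponent_c, add_comm]

theorem moment_Dhalf (n : ℕ) : moment (Dhalf n) = (-((n : ℤ) + 1), -((n : ℤ) + 1)) := by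
  simp [Dhalf, A, C, moment_single, toAdd_aExponent_a, toAdd_aExponent_c, add_comm,
    sub_eq_add_neg]

/-- The elements `D_n` and `D_{m+1/2}` lie in pairwise distinct orbits of the
left-translation action of `F` on `F →₀ ℤ × ℤ`. -/
theorem D_orbits_distinct :
    (∀ n m : ℕ, n ≠ m → ¬ ∃ g : F, act g (D n) = D m) ∧
    (∀ n m : ℕ, n ≠ m → ¬ ∃ g : F, act g (Dhalf n) = Dhalf m) ∧
    (∀ n m : ℕ, ¬ ∃ g : F, act g (D n) = Dhalf m) := by
  refine ⟨?_, ?_, ?_⟩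
  · rintro n m hnm ⟨g, hg⟩
    have h := congrArg (fun x => (moment x).2) hg
    simp only [moment_act, total_D, moment_D, Prod.snd_add, Prod.smul_snd, smul_zero,
      zero_add] at h
    exact hnm (by exact_mod_cast h)
  · rintro n m hnm ⟨g, hg⟩
    have h := congrArg (fun x => (moment x).1) hg
    simp only [moment_act, total_Dhalf, moment_Dhalf, Prod.fst_add, Prod.smul_fst, smul_zero,
      zero_add] at h
    omega
  · rintro n m ⟨g, hg⟩
    have h := congrArg (fun x => (total x).1) hg
    simp [total_act, total_D, total_Dhalf] at h

end LargeSpheres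
end
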